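/- There exist constants $C_{LU} > 0$ and $p > 2$ depending only on $C,\gamma>0$ such that for all $n\in\mathbb{N}$ and all matrices $M\in\mathbb{R}^{n\times n}$ with $\|M\|_2 \le C$ and $\max_{1\le j\le n}\|(M|_{j\times j})^{-1}\|_2 \le 1/\gamma$, the normalized $LU$-factorization $M = LU$ exists and satisfies $\|L\|_2 + \|U\|_2 + \|L^{-1}\|_2 + \|U^{-1}\|_2 \le C_{LU}\, n^{1/p}$. -/

import Mathlib

open Matrix

/-- The spectral (ℓ²-operator) norm of a real matrix. -/
noncomputable def specNorm {m n : ℕ} (M : Matrix (Fin m) (Fin n) ℝ) : ℝ :=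
  ‖LinearMap.toContinuousLinearMap (Matrix.toEuclideanLin M)‖

/-- The upper-left `j × j` principal submatrix of `M`. -/
def psub {n : ℕ} (M : Matrix (Fin n) (Fin n) ℝ) (j : ℕ) (h : j ≤ n) :
    Matrix (Fin j) (Fin j) ℝ :=
  Matrix.of fun a b => M (Fin.castLE h a) (Fin.castLE h b)

/-- `L` is lower triangular. -/
def LowerTri {n : ℕ} (L : Matrix (Fin n) (Fin n) ℝ) : Prop :=
  ∀ i j : Fin n, i < j → L i j = 0

/-- `U` is upper triangular. -/
def UpperTri {n : ℕ} (U : Matrix (Fin n) (Fin n) ℝ) : Prop :=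
  ∀ i j : Fin n, j < i → U i j = 0

section Norms

open scoped Matrix.Norms.L2Operator

theorem specNorm_eq_norm {m n : ℕ} (M : Matrix (Fin m) (Fin n) ℝ) : specNorm M = ‖M‖ := rfl

theorem specNorm_nonneg {m n : ℕ} (M : Matrix (Fin m) (Fin n) ℝ) : 0 ≤ specNorm M :=
  norm_nonneg _

theorem specNorm_add_le {m n : ℕ} (A B : Matrix (Fin m) (Fin n) ℝ) :
    specNorm (A + B) ≤ specNorm A + specNorm B := by
  simpa only [specNorm_eq_norm] using norm_add_le A B

theorem specNorm_mul_le {l m n : ℕ} (A : Matrix (Fin l) (Fin m) ℝ)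
    (B : Matrix (Fin m) (Fin n) ℝ) : specNorm (A * B) ≤ specNorm A * specNorm B := by
  simpa only [specNorm_eq_norm] using l2_opNorm_mul A B

theorem specNorm_transpose {m n : ℕ} (A : Matrix (Fin m) (Fin n) ℝ) :
    specNorm Aᵀ = specNorm A := by
  simpa only [specNorm_eq_norm, conjTranspose_eq_transpose_of_trivial]
    using l2_opNorm_conjTranspose A

theorem specNorm_transpose_mul_self {m n : ℕ} (A : Matrix (Fin m) (Fin n) ℝ) :
    specNorm (Aᵀ * A) = specNorm A ^ 2 := by
  simpa only [specNorm_eq_norm, conjTranspose_eq_transpose_of_trivial, sq]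
    using l2_opNorm_conjTranspose_mul_self A

theorem sum_sq_mulVec_le {m n : ℕ} (A : Matrix (Fin m) (Fin n) ℝ) (x : Fin n → ℝ) :
    ∑ i, (A *ᵥ x) i ^ 2 ≤ specNorm A ^ 2 * ∑ i, x i ^ 2 := by
  have h := l2_opNorm_mulVec A (WithLp.toLp 2 x)
  have h2 := pow_le_pow_left₀ (norm_nonneg _) h 2
  rw [mul_pow, EuclideanSpace.norm_sq_eq, EuclideanSpace.norm_sq_eq] at h2
  simpa [specNorm_eq_norm] using h2

end Norms

/-- The squared Frobenius norm. -/
def frobSq {m n : ℕ} (A : Matrix (Fin m) (Fin n) ℝ) : ℝ := ∑ i, ∑ j, A i j ^ 2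

theorem frobSq_nonneg {m n : ℕ} (A : Matrix (Fin m) (Fin n) ℝ) : 0 ≤ frobSq A := by
  unfold frobSq; positivity

theorem frobSq_transpose {m n : ℕ} (A : Matrix (Fin m) (Fin n) ℝ) : frobSq Aᵀ = frobSq A := by
  simp only [frobSq, transpose_apply]
  exact Finset.sum_comm

theorem trace_transpose_mul_eq_sum {m n : ℕ} (A B : Matrix (Fin m) (Fin n) ℝ) :
    (Aᵀ * B).trace = ∑ i, ∑ j, A i j * B i j := by
  simp only [trace, diag, mul_apply, transpose_apply]
  exact Finset.sum_comm

theorem frobSq_eq_trace {m n : ℕ} (A : Matrix (Fin m) (Fin n) ℝ) :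
    frobSq A = (Aᵀ * A).trace := by
  simp only [trace_transpose_mul_eq_sum, frobSq, sq]

theorem frobSq_eq_sum_columns {m n : ℕ} (A : Matrix (Fin m) (Fin n) ℝ) :
    frobSq A = ∑ j, ∑ i, A i j ^ 2 := Finset.sum_comm

theorem trace_transpose_mul_sq_le {m n : ℕ} (A B : Matrix (Fin m) (Fin n) ℝ) :
    (Aᵀ * B).trace ^ 2 ≤ frobSq A * frobSq B := by
  rw [trace_transpose_mul_eq_sum]
  simp only [frobSq, ← Fintype.sum_prod_type']
  exact Finset.sum_mul_sq_le_sq_mul_sq _ _ _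

theorem frobSq_add {m n : ℕ} (A B : Matrix (Fin m) (Fin n) ℝ) :
    frobSq (A + B) = frobSq A + 2 * (Aᵀ * B).trace + frobSq B := by
  simp only [trace_transpose_mul_eq_sum, frobSq, Matrix.add_apply, Finset.mul_sum,
    ← Finset.sum_add_distrib]
  exact Finset.sum_congr rfl fun i _ => Finset.sum_congr rfl fun j _ => by ring

theorem frobSq_smul {m n : ℕ} (c : ℝ) (A : Matrix (Fin m) (Fin n) ℝ) :
    frobSq (c • A) = c ^ 2 * frobSq A := by
  simp [frobSq, mul_pow, Finset.mul_sum]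

theorem sqrt_frobSq_add_le {m n : ℕ} (A B : Matrix (Fin m) (Fin n) ℝ) :
    √(frobSq (A + B)) ≤ √(frobSq A) + √(frobSq B) := by
  have h := Real.abs_le_sqrt (trace_transpose_mul_sq_le A B)
  rw [Real.sqrt_mul (frobSq_nonneg A)] at h
  refine Real.sqrt_le_iff.2 ⟨by positivity, ?_⟩
  rw [frobSq_add]
  nlinarith [Real.sq_sqrt (frobSq_nonneg A), Real.sq_sqrt (frobSq_nonneg B),
    le_abs_self (Aᵀ * B).trace]

theorem frobSq_mul_le {l m n : ℕ} (A : Matrix (Fin l) (Fin m) ℝ) (B : Matrix (Fin m) (Fin n) ℝ) :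
    frobSq (A * B) ≤ specNorm A ^ 2 * frobSq B := by
  rw [frobSq_eq_sum_columns, frobSq_eq_sum_columns, Finset.mul_sum]
  exact Finset.sum_le_sum fun j _ => sum_sq_mulVec_le A fun i => B i j

theorem frobSq_mul_le' {l m n : ℕ} (A : Matrix (Fin l) (Fin m) ℝ) (B : Matrix (Fin m) (Fin n) ℝ) :
    frobSq (A * B) ≤ specNorm B ^ 2 * frobSq A := by
  rw [← frobSq_transpose, transpose_mul, ← frobSq_transpose A, ← specNorm_transpose B]
  exact frobSq_mul_le _ _

theorem specNorm_le_sqrt_frobSq {m n : ℕ} (A : Matrix (Fin m) (Fin n) ℝ) :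
    specNorm A ≤ √(frobSq A) := by
  refine ContinuousLinearMap.opNorm_le_bound _ (Real.sqrt_nonneg _) fun x => ?_
  refine abs_le_of_sq_le_sq' ?_ (by positivity) |>.2
  rw [mul_pow, Real.sq_sqrt (frobSq_nonneg A), EuclideanSpace.norm_sq_eq,
    EuclideanSpace.norm_sq_eq, frobSq, Finset.sum_mul]
  refine Finset.sum_le_sum fun i _ => ?_
  have := Finset.sum_mul_sq_le_sq_mul_sq Finset.univ (A i) x.ofLp
  simpa [toLpLin_apply, mulVec, dotProduct] using this

/-- The fourth power of the Schatten `4`-norm. -/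
def schattenFour {m n : ℕ} (A : Matrix (Fin m) (Fin n) ℝ) : ℝ := frobSq (Aᵀ * A)

theorem schattenFour_nonneg {m n : ℕ} (A : Matrix (Fin m) (Fin n) ℝ) : 0 ≤ schattenFour A :=
  frobSq_nonneg _

theorem schattenFour_eq_frobSq {m n : ℕ} (A : Matrix (Fin m) (Fin n) ℝ) :
    schattenFour A = frobSq (A * Aᵀ) := by
  rw [schattenFour, frobSq_eq_trace, frobSq_eq_trace]
  simp only [transpose_mul, transpose_transpose, Matrix.mul_assoc]
  rw [trace_mul_comm]
  simp only [Matrix.mul_assoc]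

theorem frobSq_transpose_mul_sq_le {l m n : ℕ} (A : Matrix (Fin l) (Fin m) ℝ)
    (B : Matrix (Fin l) (Fin n) ℝ) :
    frobSq (Aᵀ * B) ^ 2 ≤ schattenFour A * schattenFour B := by
  have h := trace_transpose_mul_sq_le (A * Aᵀ) (B * Bᵀ)
  rw [← schattenFour_eq_frobSq, ← schattenFour_eq_frobSq] at h
  convert h using 2
  rw [frobSq_eq_trace]
  simp only [transpose_mul, transpose_transpose, Matrix.mul_assoc]
  rw [trace_mul_comm]
  simp only [Matrix.mul_assoc]

/-- The Schatten `4`-norm. -/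
noncomputable def schattenFourNorm {m n : ℕ} (A : Matrix (Fin m) (Fin n) ℝ) : ℝ :=
  √(√(schattenFour A))

theorem schattenFourNorm_nonneg {m n : ℕ} (A : Matrix (Fin m) (Fin n) ℝ) :
    0 ≤ schattenFourNorm A := Real.sqrt_nonneg _

theorem schattenFourNorm_sq {m n : ℕ} (A : Matrix (Fin m) (Fin n) ℝ) :
    schattenFourNorm A ^ 2 = √(frobSq (Aᵀ * A)) := Real.sq_sqrt (Real.sqrt_nonneg _)

theorem schattenFourNorm_pow_four {m n : ℕ} (A : Matrix (Fin m) (Fin n) ℝ) :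
    schattenFourNorm A ^ 4 = schattenFour A := by
  rw [show 4 = 2 * 2 from rfl, pow_mul, schattenFourNorm_sq, Real.sq_sqrt (frobSq_nonneg _)]
  rfl

theorem schattenFourNorm_le_of_pow_four {m n : ℕ} {A : Matrix (Fin m) (Fin n) ℝ} {c : ℝ}
    (hc : 0 ≤ c) (h : schattenFour A ≤ c ^ 4) : schattenFourNorm A ≤ c := by
  rw [← schattenFourNorm_pow_four] at h
  exact le_of_pow_le_pow_left₀ (by norm_num) hc h

theorem sqrt_frobSq_transpose_mul_le {l m n : ℕ} (A : Matrix (Fin l) (Fin m) ℝ)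
    (B : Matrix (Fin l) (Fin n) ℝ) :
    √(frobSq (Aᵀ * B)) ≤ schattenFourNorm A * schattenFourNorm B := by
  have hA := schattenFourNorm_nonneg A
  have hB := schattenFourNorm_nonneg B
  refine Real.sqrt_le_iff.2 ⟨by positivity, ?_⟩
  refine abs_le_of_sq_le_sq' ?_ (by positivity) |>.2
  refine (frobSq_transpose_mul_sq_le A B).trans_eq ?_
  rw [← schattenFourNorm_pow_four, ← schattenFourNorm_pow_four]
  ring

theorem schattenFourNorm_add_le {m n : ℕ} (A B : Matrix (Fin m) (Fin n) ℝ) :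
    schattenFourNorm (A + B) ≤ schattenFourNorm A + schattenFourNorm B := by
  have hA := schattenFourNorm_nonneg A
  have hB := schattenFourNorm_nonneg B
  refine abs_le_of_sq_le_sq' ?_ (by positivity) |>.2
  rw [schattenFourNorm_sq, transpose_add, Matrix.add_mul, Matrix.mul_add, Matrix.mul_add]
  have h1 := sqrt_frobSq_add_le (Aᵀ * A + Aᵀ * B) (Bᵀ * A + Bᵀ * B)
  have h2 := sqrt_frobSq_add_le (Aᵀ * A) (Aᵀ * B)
  have h3 := sqrt_frobSq_add_le (Bᵀ * A) (Bᵀ * B)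
  nlinarith [sqrt_frobSq_transpose_mul_le A B, sqrt_frobSq_transpose_mul_le B A,
    sqrt_frobSq_transpose_mul_le A A, sqrt_frobSq_transpose_mul_le B B]

theorem schattenFourNorm_smul {m n : ℕ} (c : ℝ) (A : Matrix (Fin m) (Fin n) ℝ) :
    schattenFourNorm (c • A) = |c| * schattenFourNorm A := by
  rw [schattenFourNorm, schattenFourNorm, schattenFour, transpose_smul, Matrix.smul_mul,
    Matrix.mul_smul, smul_smul, frobSq_smul, Real.sqrt_mul (by positivity),
    Real.sqrt_sq (mul_self_nonneg c), Real.sqrt_mul (mul_self_nonneg c),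
    Real.sqrt_mul_self_eq_abs]
  rfl

theorem schattenFourNorm_mul_le {l m n : ℕ} (A : Matrix (Fin l) (Fin m) ℝ)
    (B : Matrix (Fin m) (Fin n) ℝ) :
    schattenFourNorm (A * B) ≤ specNorm A * schattenFourNorm B := by
  have hA := specNorm_nonneg A
  have hB := schattenFourNorm_nonneg B
  refine schattenFourNorm_le_of_pow_four (by positivity) ?_
  rw [schattenFour_eq_frobSq, mul_pow, schattenFourNorm_pow_four, schattenFour_eq_frobSq,
    transpose_mul, Matrix.mul_assoc, ← Matrix.mul_assoc B]
  calc _ ≤ specNorm A ^ 2 * frobSq (B * Bᵀ * Aᵀ) := frobSq_mul_le _ _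
    _ ≤ specNorm A ^ 2 * (specNorm Aᵀ ^ 2 * frobSq (B * Bᵀ)) := by
        gcongr; exact frobSq_mul_le' _ _
    _ = _ := by rw [specNorm_transpose]; ring

theorem specNorm_le_schattenFourNorm {m n : ℕ} (A : Matrix (Fin m) (Fin n) ℝ) :
    specNorm A ≤ schattenFourNorm A := by
  refine abs_le_of_sq_le_sq' ?_ (schattenFourNorm_nonneg A) |>.2
  rw [schattenFourNorm_sq, ← specNorm_transpose_mul_self]
  exact specNorm_le_sqrt_frobSq _

/-- The upper triangular part of a matrix, including the diagonal. -/
def upperPart {n : ℕ} (A : Matrix (Fin n) (Fin n) ℝ) : Matrix (Fin n) (Fin n) ℝ :=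
  Matrix.of fun i j => if i ≤ j then A i j else 0

theorem upperPart_apply {n : ℕ} (A : Matrix (Fin n) (Fin n) ℝ) (i j : Fin n) :
    upperPart A i j = if i ≤ j then A i j else 0 := rfl

theorem upperTri_upperPart {n : ℕ} (A : Matrix (Fin n) (Fin n) ℝ) : UpperTri (upperPart A) :=
  fun _ _ h => if_neg h.not_ge

theorem upperPart_sub {n : ℕ} (A B : Matrix (Fin n) (Fin n) ℝ) :
    upperPart (A - B) = upperPart A - upperPart B := by
  ext i j; simp only [upperPart_apply, Matrix.sub_apply]; split_ifs <;> simp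

theorem frobSq_upperPart_le {n : ℕ} (A : Matrix (Fin n) (Fin n) ℝ) :
    frobSq (upperPart A) ≤ frobSq A := by
  refine Finset.sum_le_sum fun i _ => Finset.sum_le_sum fun j _ => ?_
  rw [upperPart_apply]; split_ifs <;> simp [sq_nonneg]

theorem trace_transpose_mul_upperPart {n : ℕ} {A : Matrix (Fin n) (Fin n) ℝ} (hA : UpperTri A)
    (B : Matrix (Fin n) (Fin n) ℝ) : (Aᵀ * upperPart B).trace = (Aᵀ * B).trace := by
  rw [trace_transpose_mul_eq_sum, trace_transpose_mul_eq_sum]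
  refine Finset.sum_congr rfl fun i _ => Finset.sum_congr rfl fun j _ => ?_
  rw [upperPart_apply]
  split_ifs with h
  · rfl
  · rw [hA i j (not_le.1 h)]; simp

theorem frobSq_le_of_isSymm {n : ℕ} {A : Matrix (Fin n) (Fin n) ℝ} (hA : Aᵀ = A) :
    frobSq A ≤ 2 * frobSq (upperPart A) := by
  have h : frobSq A ≤ frobSq (upperPart A) + frobSq (upperPart A)ᵀ := by
    simp only [frobSq, ← Finset.sum_add_distrib]
    refine Finset.sum_le_sum fun i _ => Finset.sum_le_sum fun j _ => ?_
    have hij : A j i = A i j := congrFun (congrFun hA i) j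
    simp only [transpose_apply, upperPart_apply, hij]
    rcases le_total i j with h | h <;> simp only [h, if_true] <;> split_ifs <;>
      nlinarith [sq_nonneg (A i j)]
  rw [frobSq_transpose] at h
  linarith

theorem upperPart_transpose_mul {n : ℕ} (A : Matrix (Fin n) (Fin n) ℝ) :
    upperPart ((upperPart A)ᵀ * upperPart A) = upperPart ((upperPart A)ᵀ * A) := by
  ext i j
  simp only [upperPart_apply (_ * _), mul_apply, transpose_apply]
  split_ifs with h
  · refine Finset.sum_congr rfl fun k _ => ?_
    by_cases hk : k ≤ i
    · simp [upperPart_apply, hk, hk.trans h]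
    · simp [upperPart_apply, hk]
  · rfl

theorem schattenFour_upperPart_le {n : ℕ} (A : Matrix (Fin n) (Fin n) ℝ) :
    schattenFour (upperPart A) ≤ 4 * schattenFour A := by
  have h1 : schattenFour (upperPart A) ≤ 2 * frobSq ((upperPart A)ᵀ * A) := by
    refine (frobSq_le_of_isSymm (by simp)).trans ?_
    rw [upperPart_transpose_mul]
    gcongr
    exact frobSq_upperPart_le _
  have h2 := frobSq_transpose_mul_sq_le (upperPart A) A
  have h3 := schattenFour_nonneg (upperPart A)
  have h4 := schattenFour_nonneg A
  rcases h3.eq_or_lt with h | h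
  · rw [← h]; positivity
  · refine le_of_mul_le_mul_left ?_ h
    nlinarith [frobSq_nonneg ((upperPart A)ᵀ * A)]

theorem schattenFourNorm_upperPart_le {n : ℕ} (A : Matrix (Fin n) (Fin n) ℝ) :
    schattenFourNorm (upperPart A) ≤ √2 * schattenFourNorm A := by
  have := schattenFourNorm_nonneg A
  refine schattenFourNorm_le_of_pow_four (by positivity) ?_
  rw [mul_pow, schattenFourNorm_pow_four, show 4 = 2 * 2 from rfl, pow_mul √2,
    Real.sq_sqrt (by norm_num)]
  exact (schattenFour_upperPart_le A).trans_eq (by norm_num)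

theorem frobSq_diagonal_le {n : ℕ} {d : Fin n → ℝ} {δ : ℝ} (h : ∀ i, |d i| ≤ δ) :
    frobSq (diagonal d) ≤ n * δ ^ 2 := by
  have h1 : frobSq (diagonal d) = ∑ i, d i ^ 2 :=
    Finset.sum_congr rfl fun i _ => by
      rw [Finset.sum_eq_single i (fun j _ hj => by simp [diagonal_apply_ne' d hj]) (by simp)]
      simp
  have h2 : ∑ i, d i ^ 2 ≤ ∑ _i : Fin n, δ ^ 2 :=
    Finset.sum_le_sum fun i _ => sq_le_sq.2 ((h i).trans (le_abs_self δ))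
  simpa [h1] using h2

theorem schattenFourNorm_diagonal_le {n : ℕ} {d : Fin n → ℝ} {δ : ℝ} (hδ : 0 ≤ δ)
    (h : ∀ i, |d i| ≤ δ) : schattenFourNorm (diagonal d) ≤ δ * √(√n) := by
  refine schattenFourNorm_le_of_pow_four (by positivity) ?_
  rw [schattenFour, diagonal_transpose, diagonal_mul_diagonal]
  refine (frobSq_diagonal_le (δ := δ ^ 2) fun i => ?_).trans_eq ?_
  · rw [← sq, abs_pow]
    exact pow_le_pow_left₀ (abs_nonneg _) (h i) 2
  · rw [mul_pow, show 4 = 2 * 2 from rfl, pow_mul √(√(n : ℝ)), Real.sq_sqrt (by positivity),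
      Real.sq_sqrt (by positivity)]
    ring

/-- The leading principal submatrices of `M` are bounded below by `γ`. -/
def InfSup {n : ℕ} (γ : ℝ) (M : Matrix (Fin n) (Fin n) ℝ) : Prop :=
  ∀ k ≤ n, ∀ x : Fin n → ℝ, (∀ i : Fin n, k ≤ i → x i = 0) →
    γ ^ 2 * ∑ i, x i ^ 2 ≤ ∑ i : Fin n, if i.val < k then (M *ᵥ x) i ^ 2 else 0

theorem InfSup.frobSq_le {n : ℕ} {γ : ℝ} {M V : Matrix (Fin n) (Fin n) ℝ} (hM : InfSup γ M)
    (hV : UpperTri V) : γ ^ 2 * frobSq V ≤ frobSq (upperPart (M * V)) := by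
  rw [frobSq_eq_sum_columns, frobSq_eq_sum_columns, Finset.mul_sum]
  refine Finset.sum_le_sum fun j _ => ?_
  refine (hM (j + 1) j.isLt (fun i => V i j) fun i hi => hV i j (Nat.lt_of_succ_le hi)).trans_eq ?_
  refine Finset.sum_congr rfl fun i _ => ?_
  simp only [upperPart_apply, Fin.le_def, Nat.lt_succ_iff]
  split_ifs
  · rfl
  · simp

/-- One step of the Richardson iteration for the triangular system `upperPart (M * V) = Δ`
(homogeneous part). -/
noncomputable def richardson {n : ℕ} (C : ℝ) (M V : Matrix (Fin n) (Fin n) ℝ) :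
    Matrix (Fin n) (Fin n) ℝ :=
  V + (-(C ^ 2)⁻¹) • upperPart (Mᵀ * upperPart (M * V))

theorem richardson_sub {n : ℕ} (C : ℝ) (M V W : Matrix (Fin n) (Fin n) ℝ) :
    richardson C M (V - W) = richardson C M V - richardson C M W := by
  simp only [richardson, Matrix.mul_sub, upperPart_sub, smul_sub]
  abel

theorem upperTri_richardson {n : ℕ} (C : ℝ) (M : Matrix (Fin n) (Fin n) ℝ)
    {V : Matrix (Fin n) (Fin n) ℝ} (hV : UpperTri V) : UpperTri (richardson C M V) := by
  intro i j h
  simp [richardson, hV i j h, upperTri_upperPart _ i j h]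

theorem frobSq_richardson_le {n : ℕ} {C γ : ℝ} (hC : 0 < C) {M V : Matrix (Fin n) (Fin n) ℝ}
    (hMC : specNorm M ≤ C) (hM : InfSup γ M) (hV : UpperTri V) :
    frobSq (richardson C M V) ≤ (1 - γ ^ 2 / C ^ 2) * frobSq V := by
  set W := upperPart (M * V) with hW
  have h1 : (Vᵀ * upperPart (Mᵀ * W)).trace = frobSq W := by
    rw [trace_transpose_mul_upperPart hV, frobSq_eq_trace, hW,
      trace_transpose_mul_upperPart (upperTri_upperPart _), ← hW, ← Matrix.mul_assoc,
      ← transpose_mul, ← trace_transpose, transpose_mul, transpose_transpose]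
  have h2 : frobSq (upperPart (Mᵀ * W)) ≤ C ^ 2 * frobSq W := by
    refine (frobSq_upperPart_le _).trans ((frobSq_mul_le _ _).trans ?_)
    rw [specNorm_transpose]
    have := specNorm_nonneg M
    have := frobSq_nonneg W
    gcongr
  have h3 : γ ^ 2 * frobSq V ≤ frobSq W := hM.frobSq_le hV
  rw [richardson, frobSq_add, frobSq_smul, Matrix.mul_smul, trace_smul, ← hW, h1, smul_eq_mul]
  have hC2 : 0 < C ^ 2 := by positivity
  calc frobSq V + 2 * (-(C ^ 2)⁻¹ * frobSq W) + (-(C ^ 2)⁻¹) ^ 2 * frobSq (upperPart (Mᵀ * W))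
      ≤ frobSq V + 2 * (-(C ^ 2)⁻¹ * frobSq W) + (-(C ^ 2)⁻¹) ^ 2 * (C ^ 2 * frobSq W) := by
        gcongr
    _ = frobSq V - (C ^ 2)⁻¹ * frobSq W := by field_simp; ring
    _ ≤ frobSq V - (C ^ 2)⁻¹ * (γ ^ 2 * frobSq V) := by gcongr
    _ = _ := by ring

theorem schattenFourNorm_residual_le {n : ℕ} {C : ℝ}
    {M : Matrix (Fin n) (Fin n) ℝ} (hMC : specNorm M ≤ C) (W : Matrix (Fin n) (Fin n) ℝ) :
    schattenFourNorm (upperPart (Mᵀ * W)) ≤ √2 * (C * schattenFourNorm W) := by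
  refine (schattenFourNorm_upperPart_le _).trans ?_
  gcongr
  refine (schattenFourNorm_mul_le _ _).trans ?_
  rw [specNorm_transpose]
  exact mul_le_mul_of_nonneg_right hMC (schattenFourNorm_nonneg _)

theorem schattenFourNorm_richardson_le {n : ℕ} {C : ℝ} (hC : 0 < C)
    {M : Matrix (Fin n) (Fin n) ℝ} (hMC : specNorm M ≤ C) (V : Matrix (Fin n) (Fin n) ℝ) :
    schattenFourNorm (richardson C M V) ≤ 3 * schattenFourNorm V := by
  have h1 : schattenFourNorm (upperPart (M * V)) ≤ √2 * (C * schattenFourNorm V) := by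
    have := schattenFourNorm_residual_le (C := C) (M := Mᵀ) (by rwa [specNorm_transpose]) V
    rwa [transpose_transpose] at this
  have h2 : schattenFourNorm (upperPart (Mᵀ * upperPart (M * V)))
      ≤ √2 * (C * (√2 * (C * schattenFourNorm V))) :=
    (schattenFourNorm_residual_le hMC _).trans (by gcongr)
  refine (schattenFourNorm_add_le _ _).trans ?_
  rw [schattenFourNorm_smul, abs_neg, abs_of_pos (by positivity)]
  have h3 : (C ^ 2)⁻¹ * schattenFourNorm (upperPart (Mᵀ * upperPart (M * V)))
      ≤ (C ^ 2)⁻¹ * (√2 * (C * (√2 * (C * schattenFourNorm V)))) := by gcongr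
  have h4 : (C ^ 2)⁻¹ * (√2 * (C * (√2 * (C * schattenFourNorm V)))) =
      √2 ^ 2 * schattenFourNorm V := by field_simp
  rw [h4, Real.sq_sqrt (by norm_num)] at h3
  linarith

theorem exists_richardson_approx {n : ℕ} {C γ : ℝ} (hC : 0 < C) {M V : Matrix (Fin n) (Fin n) ℝ}
    (hMC : specNorm M ≤ C) (hM : InfSup γ M) (hV : UpperTri V) (l : ℕ) :
    ∃ S : Matrix (Fin n) (Fin n) ℝ, UpperTri (V - S) ∧
      √(frobSq (V - S)) ≤ √(1 - γ ^ 2 / C ^ 2) ^ l * √(frobSq V) ∧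
      schattenFourNorm S ≤
        (3 ^ l - 1) * schattenFourNorm ((C ^ 2)⁻¹ • upperPart (Mᵀ * upperPart (M * V))) := by
  set R := (C ^ 2)⁻¹ • upperPart (Mᵀ * upperPart (M * V)) with hR
  have hVR : V = richardson C M V + R := by
    rw [richardson, hR, add_assoc, ← add_smul]; simp
  induction l with
  | zero =>
    refine ⟨0, by simpa using hV, by simp, ?_⟩
    have : (0 : Matrix (Fin n) (Fin n) ℝ) = (0 : ℝ) • 0 := by simp
    rw [this, schattenFourNorm_smul]
    simp
  | succ l ih =>
    obtain ⟨S, hS1, hS2, hS3⟩ := ih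
    have hVS : V - (richardson C M S + R) = richardson C M (V - S) := by
      conv_lhs => rw [hVR]
      rw [richardson_sub]; abel
    refine ⟨richardson C M S + R, ?_, ?_, ?_⟩
    · rw [hVS]; exact upperTri_richardson C M hS1
    · rw [hVS, pow_succ', mul_assoc]
      refine (Real.sqrt_le_sqrt (frobSq_richardson_le hC hMC hM hS1)).trans ?_
      rw [Real.sqrt_mul' _ (frobSq_nonneg _)]
      gcongr
    · refine (schattenFourNorm_add_le _ _).trans ?_
      have := schattenFourNorm_richardson_le hC hMC S
      have := schattenFourNorm_nonneg R
      rw [pow_succ]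
      linarith

theorem specNorm_le_of_upperPart_mul_eq_diagonal {n : ℕ} {C γ δ : ℝ} (hC : 0 < C) (hγ : 0 < γ)
    (hδ : 0 ≤ δ) {M V : Matrix (Fin n) (Fin n) ℝ} (hMC : specNorm M ≤ C) (hM : InfSup γ M)
    (hV : UpperTri V) {d : Fin n → ℝ} (hd : ∀ i, |d i| ≤ δ)
    (hMV : upperPart (M * V) = diagonal d) (l : ℕ) :
    specNorm V ≤ δ / γ * (√(1 - γ ^ 2 / C ^ 2) ^ l * √n) + √2 * δ / C * (3 ^ l * √(√n)) := by
  obtain ⟨S, -, hS2, hS3⟩ := exists_richardson_approx hC hMC hM hV l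
  have hVn : √(frobSq V) ≤ δ / γ * √n := by
    refine Real.sqrt_le_iff.2 ⟨by positivity, ?_⟩
    have h := (hM.frobSq_le hV).trans (hMV ▸ frobSq_diagonal_le hd)
    rw [mul_pow, Real.sq_sqrt (by positivity), div_pow, div_mul_eq_mul_div,
      le_div_iff₀ (by positivity)]
    linarith
  have hR : schattenFourNorm ((C ^ 2)⁻¹ • upperPart (Mᵀ * upperPart (M * V)))
      ≤ √2 * δ / C * √(√n) := by
    rw [schattenFourNorm_smul, abs_of_pos (by positivity), hMV]
    calc _ ≤ (C ^ 2)⁻¹ * (√2 * (C * (δ * √(√n)))) := by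
          gcongr
          refine (schattenFourNorm_residual_le hMC _).trans ?_
          gcongr
          exact schattenFourNorm_diagonal_le hδ hd
      _ = _ := by field_simp
  have h3 : (0 : ℝ) ≤ 3 ^ l - 1 := sub_nonneg.2 (one_le_pow₀ (by norm_num))
  calc specNorm V = specNorm ((V - S) + S) := by rw [sub_add_cancel]
    _ ≤ √(frobSq (V - S)) + schattenFourNorm S :=
        (specNorm_add_le _ _).trans
          (add_le_add (specNorm_le_sqrt_frobSq _) (specNorm_le_schattenFourNorm _))
    _ ≤ √(1 - γ ^ 2 / C ^ 2) ^ l * (δ / γ * √n) + (3 ^ l - 1) * (√2 * δ / C * √(√n)) := by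
        refine add_le_add (hS2.trans (by gcongr)) (hS3.trans (by gcongr))
    _ ≤ √(1 - γ ^ 2 / C ^ 2) ^ l * (δ / γ * √n) + 3 ^ l * (√2 * δ / C * √(√n)) := by
        gcongr; linarith
    _ = _ := by ring

theorem exists_nat_geometric_balance {ρ : ℝ} (h0 : 0 < ρ) (h1 : ρ < 1) :
    ∃ e : ℝ, 0 < e ∧ e < 1 / 2 ∧ ∀ n : ℕ, 1 ≤ n → ∃ l : ℕ,
      ρ ^ l * √n ≤ ρ⁻¹ * (n : ℝ) ^ e ∧ 3 ^ l * √(√n) ≤ (n : ℝ) ^ e := by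
  have hlog3 : 0 < Real.log 3 := Real.log_pos (by norm_num)
  have hlogρ : Real.log ρ < 0 := Real.log_neg h0 h1
  set s := 1 / (8 * Real.log 3) with hs
  have hs0 : 0 < s := by positivity
  refine ⟨max (3 / 8) (1 / 2 + s * Real.log ρ), lt_max_of_lt_left (by norm_num),
    max_lt (by norm_num) (by nlinarith), fun n hn => ⟨⌊s * Real.log n⌋₊, ?_, ?_⟩⟩
  all_goals
    have hn1 : (1 : ℝ) ≤ n := by exact_mod_cast hn
    have hn0 : (0 : ℝ) < n := by linarith
    have hlogn : 0 ≤ Real.log n := Real.log_nonneg hn1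
    set l := ⌊s * Real.log n⌋₊ with hl
  · have hl1 : s * Real.log n - 1 ≤ l := (Nat.sub_one_lt_floor _).le
    have hρl : ρ ^ l ≤ ρ⁻¹ * (n : ℝ) ^ (s * Real.log ρ) := by
      rw [← Real.rpow_natCast, Real.rpow_def_of_pos h0, Real.rpow_def_of_pos hn0]
      nth_rw 2 [← Real.exp_log h0]
      rw [← Real.exp_neg, ← Real.exp_add]
      exact Real.exp_le_exp.2 (by nlinarith)
    calc ρ ^ l * √n ≤ ρ⁻¹ * (n : ℝ) ^ (s * Real.log ρ) * (n : ℝ) ^ (1 / 2 : ℝ) := by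
          rw [Real.sqrt_eq_rpow]; gcongr
      _ = ρ⁻¹ * (n : ℝ) ^ (1 / 2 + s * Real.log ρ) := by
          rw [mul_assoc, ← Real.rpow_add hn0, add_comm]
      _ ≤ _ := by gcongr; exact le_max_right _ _
  · have hl1 : (l : ℝ) ≤ s * Real.log n := Nat.floor_le (by positivity)
    have h3l : (3 : ℝ) ^ l ≤ (n : ℝ) ^ (1 / 8 : ℝ) := by
      rw [← Real.rpow_natCast, Real.rpow_def_of_pos (by norm_num), Real.rpow_def_of_pos hn0]
      refine Real.exp_le_exp.2 ?_
      calc Real.log 3 * l ≤ Real.log 3 * (s * Real.log n) := by gcongr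
        _ = _ := by rw [hs]; field_simp
    calc 3 ^ l * √(√n) ≤ (n : ℝ) ^ (1 / 8 : ℝ) * (n : ℝ) ^ (1 / 4 : ℝ) := by
          rw [Real.sqrt_eq_rpow, Real.sqrt_eq_rpow, ← Real.rpow_mul hn0.le]
          norm_num at h3l ⊢
          gcongr
      _ = (n : ℝ) ^ (3 / 8 : ℝ) := by rw [← Real.rpow_add hn0]; norm_num
      _ ≤ _ := by gcongr; exact le_max_left _ _

theorem sum_eq_sum_castLE {n k : ℕ} (h : k ≤ n) {f : Fin n → ℝ}
    (hf : ∀ i : Fin n, k ≤ i → f i = 0) : ∑ i, f i = ∑ a : Fin k, f (Fin.castLE h a) := by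
  obtain ⟨m, rfl⟩ := Nat.exists_eq_add_of_le h
  rw [Fin.sum_univ_add, Finset.sum_eq_zero fun i _ => hf (Fin.natAdd k i) (by simp), add_zero]
  rfl

theorem psub_mulVec {n k : ℕ} (h : k ≤ n) (M : Matrix (Fin n) (Fin n) ℝ) {x : Fin n → ℝ}
    (hx : ∀ i : Fin n, k ≤ i → x i = 0) (a : Fin k) :
    (psub M k h *ᵥ fun b => x (Fin.castLE h b)) a = (M *ᵥ x) (Fin.castLE h a) := by
  simp only [mulVec, dotProduct]
  rw [sum_eq_sum_castLE h fun i hi => by rw [hx i hi, mul_zero]]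
  rfl

theorem infSup_of_psub {n : ℕ} {γ : ℝ} (hγ : 0 < γ) {M : Matrix (Fin n) (Fin n) ℝ}
    (hM : ∀ (j : ℕ) (h : j ≤ n), 1 ≤ j →
      IsUnit (psub M j h) ∧ specNorm (psub M j h)⁻¹ ≤ 1 / γ) : InfSup γ M := by
  intro k hk x hx
  rw [sum_eq_sum_castLE hk fun i hi => by rw [hx i hi]; simp,
    sum_eq_sum_castLE hk fun i hi => if_neg hi.not_gt]
  simp only [Fin.val_castLE, Fin.is_lt, if_true]
  rcases Nat.eq_zero_or_pos k with rfl | hk0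
  · simp
  obtain ⟨hu, hn⟩ := hM k hk hk0
  have h := sum_sq_mulVec_le (psub M k hk)⁻¹ (psub M k hk *ᵥ fun b => x (Fin.castLE hk b))
  rw [mulVec_mulVec, nonsing_inv_mul _ ((isUnit_iff_isUnit_det _).1 hu), one_mulVec] at h
  simp only [psub_mulVec hk M hx] at h
  have h2 : specNorm (psub M k hk)⁻¹ ^ 2 ≤ (1 / γ) ^ 2 :=
    pow_le_pow_left₀ (specNorm_nonneg _) hn 2
  calc γ ^ 2 * ∑ a : Fin k, x (Fin.castLE hk a) ^ 2
      ≤ γ ^ 2 * ((1 / γ) ^ 2 * ∑ a : Fin k, (M *ᵥ x) (Fin.castLE hk a) ^ 2) := by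
        gcongr
        exact h.trans (by gcongr)
    _ = _ := by field_simp

theorem infSup_transpose_of_psub {n : ℕ} {γ : ℝ} (hγ : 0 < γ) {M : Matrix (Fin n) (Fin n) ℝ}
    (hM : ∀ (j : ℕ) (h : j ≤ n), 1 ≤ j →
      IsUnit (psub M j h) ∧ specNorm (psub M j h)⁻¹ ≤ 1 / γ) : InfSup γ Mᵀ := by
  refine infSup_of_psub hγ fun j h hj => ?_
  obtain ⟨hu, hn⟩ := hM j h hj
  rw [show psub Mᵀ j h = (psub M j h)ᵀ from rfl, ← transpose_nonsing_inv, specNorm_transpose]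
  exact ⟨(isUnit_transpose _).2 hu, hn⟩

theorem exists_upperTri_upperPart_mul_eq_one {n : ℕ} {M : Matrix (Fin n) (Fin n) ℝ}
    (hM : ∀ (j : ℕ) (h : j ≤ n), 1 ≤ j → IsUnit (psub M j h)) :
    ∃ V : Matrix (Fin n) (Fin n) ℝ, UpperTri V ∧ upperPart (M * V) = 1 := by
  refine ⟨Matrix.of fun i j => if h : i ≤ j then
    (psub M (j + 1) j.isLt)⁻¹ ⟨i, Nat.lt_succ_of_le h⟩ (Fin.last j) else 0,
    fun i j h => dif_neg h.not_ge, ?_⟩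
  ext i j
  rw [upperPart_apply]
  split_ifs with h
  · have hu := (isUnit_iff_isUnit_det _).1 (hM (j + 1) j.isLt (Nat.succ_pos _))
    have h1 := congrFun (congrFun (mul_nonsing_inv _ hu) ⟨i, Nat.lt_succ_of_le h⟩) (Fin.last j)
    rw [mul_apply, sum_eq_sum_castLE (k := j + 1) j.isLt fun k hk => ?_]
    · rw [mul_apply] at h1
      refine Eq.trans (Finset.sum_congr rfl fun a _ => ?_) (h1.trans ?_)
      · have ha : Fin.castLE j.isLt a ≤ j := Nat.lt_succ_iff.1 a.isLt
        simp only [of_apply, ha, dif_pos]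
        rfl
      · simp [one_apply, Fin.ext_iff]
    · have hkj : ¬ k ≤ j := not_le.2 (Fin.lt_def.2 hk)
      simp [hkj]
  · rw [one_apply_ne]
    rintro rfl
    exact h le_rfl

theorem UpperTri.inv {n : ℕ} {U : Matrix (Fin n) (Fin n) ℝ} (hU : UpperTri U) (h : IsUnit U) :
    UpperTri U⁻¹ := by
  let := h.invertible
  have : U.BlockTriangular id := fun i j hij => hU i j hij
  exact fun i j hij => blockTriangular_inv_of_blockTriangular this hij

theorem LowerTri.transpose {n : ℕ} {L : Matrix (Fin n) (Fin n) ℝ} (hL : LowerTri L) :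
    UpperTri Lᵀ := fun i j h => hL j i h

theorem UpperTri.mul_apply_diag {n : ℕ} {A B : Matrix (Fin n) (Fin n) ℝ} (hA : UpperTri A)
    (hB : UpperTri B) (i : Fin n) : (A * B) i i = A i i * B i i := by
  rw [mul_apply]
  refine Finset.sum_eq_single i (fun k _ hk => ?_) (by simp)
  rcases lt_or_gt_of_ne hk with h | h
  · rw [hA i k h, zero_mul]
  · rw [hB k i h, mul_zero]

theorem UpperTri.isUnit {n : ℕ} {U : Matrix (Fin n) (Fin n) ℝ} (hU : UpperTri U)
    (hd : ∀ i, U i i = 1) : IsUnit U := by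
  rw [isUnit_iff_isUnit_det, det_of_isUpperTriangular fun i j hij => hU i j hij]
  simp [hd]

theorem InfSup.abs_mul_apply_diag_le {n : ℕ} {C γ : ℝ} (hC : 0 < C) (hγ : 0 < γ)
    {M W : Matrix (Fin n) (Fin n) ℝ} (hMC : specNorm M ≤ C) (hM : InfSup γ M) (hW : UpperTri W)
    (hW1 : ∀ i, W i i = 1) (hMW : ∀ i j, i < j → (M * W) i j = 0) (j : Fin n) :
    |(M * W) j j| ≤ C * (C / γ) + C := by
  set x : Fin n → ℝ := fun i => W i j - (Pi.single j 1 : Fin n → ℝ) i with hx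
  have hMx : ∀ i, (M *ᵥ x) i = (M * W) i j - M i j := by
    intro i
    have : x = (fun i => W i j) - Pi.single j 1 := rfl
    rw [this, mulVec_sub, Pi.sub_apply, mulVec_single_one]
    rfl
  have hcol : ∑ i, M i j ^ 2 ≤ C ^ 2 := by
    have h := sum_sq_mulVec_le M (Pi.single j 1)
    rw [mulVec_single_one] at h
    have h1 : ∑ i, (Pi.single j 1 : Fin n → ℝ) i ^ 2 = 1 := by
      rw [Finset.sum_eq_single j (fun i _ hi => by simp [hi]) (by simp)]; simp
    rw [h1, mul_one] at h
    exact h.trans (pow_le_pow_left₀ (specNorm_nonneg _) hMC 2)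
  have hxn : ∑ i, x i ^ 2 ≤ (C / γ) ^ 2 := by
    have h := hM j j.isLt.le x fun i hi => by
      rcases (Fin.le_def.2 hi).eq_or_lt with rfl | hij
      · simp [hx, hW1]
      · simp [hx, hW i j hij, hij.ne']
    rw [div_pow, le_div_iff₀ (by positivity), mul_comm]
    refine h.trans ((Finset.sum_le_sum fun i _ => ?_).trans hcol)
    split_ifs with hij
    · rw [hMx, hMW i j hij]; simp
    · positivity
  have h1 : |(M *ᵥ x) j| ≤ C * (C / γ) := by
    refine abs_le_of_sq_le_sq ?_ (by positivity)
    calc (M *ᵥ x) j ^ 2 ≤ ∑ i, (M *ᵥ x) i ^ 2 :=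
          Finset.single_le_sum (f := fun i => (M *ᵥ x) i ^ 2) (fun i _ => sq_nonneg _)
            (Finset.mem_univ j)
      _ ≤ specNorm M ^ 2 * ∑ i, x i ^ 2 := sum_sq_mulVec_le M x
      _ ≤ C ^ 2 * (C / γ) ^ 2 := by
          have := specNorm_nonneg M
          gcongr
      _ = _ := by ring
  have h2 : |M j j| ≤ C := by
    refine abs_le_of_sq_le_sq ?_ hC.le
    exact (Finset.single_le_sum (f := fun i => M i j ^ 2) (fun i _ => sq_nonneg _)
      (Finset.mem_univ j)).trans hcol
  have h3 : (M * W) j j = (M *ᵥ x) j + M j j := by rw [hMx]; ring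
  rw [h3]
  exact (abs_add_le _ _).trans (add_le_add h1 h2)

/-- Theorem `thm:LUbound`: there are `C_LU > 0` and `p > 2` depending
only on `C, γ` such that every uniformly bounded matrix with uniformly invertible
principal submatrices has a normalized `LU`-factorization with
`‖L‖₂ + ‖U‖₂ + ‖L⁻¹‖₂ + ‖U⁻¹‖₂ ≤ C_LU n^{1/p}`. -/
theorem stmt_12 (C γ : ℝ) (hC : 0 < C) (hγ : 0 < γ) :
    ∃ CLU : ℝ, 0 < CLU ∧ ∃ p : ℝ, 2 < p ∧
      ∀ (n : ℕ) (M : Matrix (Fin n) (Fin n) ℝ),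
        specNorm M ≤ C →
        (∀ (j : ℕ) (h : j ≤ n), 1 ≤ j →
          IsUnit (psub M j h) ∧ specNorm (psub M j h)⁻¹ ≤ 1 / γ) →
        ∃ L U : Matrix (Fin n) (Fin n) ℝ,
          LowerTri L ∧ (∀ i, L i i = 1) ∧ UpperTri U ∧ M = L * U ∧
          IsUnit L ∧ IsUnit U ∧
          specNorm L + specNorm U + specNorm L⁻¹ + specNorm U⁻¹ ≤
            CLU * (n : ℝ) ^ ((1 : ℝ) / p) := by
  set B := C + γ with hB
  have hB0 : 0 < B := by positivity
  set δ := B * (B / γ) + B with hδ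
  have hδ0 : 0 < δ := by positivity
  have hq : 0 < 1 - γ ^ 2 / B ^ 2 := by
    rw [sub_pos, div_lt_one (by positivity)]
    gcongr
    linarith
  have hρ1 : √(1 - γ ^ 2 / B ^ 2) < 1 := by
    rw [Real.sqrt_lt' one_pos]
    have : 0 < γ ^ 2 / B ^ 2 := by positivity
    linarith
  have hρ0 := Real.sqrt_pos.2 hq
  set ρ := √(1 - γ ^ 2 / B ^ 2) with hρ
  obtain ⟨e, he0, he1, he⟩ := exists_nat_geometric_balance hρ0 hρ1
  set K : ℝ → ℝ := fun t => t / γ * ρ⁻¹ + √2 * t / B with hK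
  have hKpos : ∀ t, 0 < t → 0 < K t := fun t ht => by positivity
  refine ⟨(B + 1) * (K 1 + K δ), ?_, 1 / e, ?_, fun n M hMC hM => ?_⟩
  · have := hKpos 1 one_pos
    have := hKpos δ hδ0
    positivity
  · rw [lt_div_iff₀ he0]; linarith
  rw [one_div_one_div]
  obtain ⟨V, hV, hMV⟩ := exists_upperTri_upperPart_mul_eq_one fun j h hj => (hM j h hj).1
  have hMVij : ∀ i j, i ≤ j → (M * V) i j = (1 : Matrix (Fin n) (Fin n) ℝ) i j := fun i j h => by
    rw [← hMV, upperPart_apply, if_pos h]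
  have hL : LowerTri (M * V) := fun i j h => by rw [hMVij i j h.le, one_apply_ne h.ne]
  have hL1 : ∀ i, (M * V) i i = 1 := fun i => by rw [hMVij i i le_rfl, one_apply_eq]
  have hLT : IsUnit (M * V)ᵀ := hL.transpose.isUnit hL1
  have hLu : IsUnit (M * V) := (isUnit_transpose _).1 hLT
  have hVu : IsUnit V := by
    rw [isUnit_iff_isUnit_det, det_mul] at hLu
    exact (isUnit_iff_isUnit_det _).2 (isUnit_of_mul_isUnit_right hLu)
  have hVd := (isUnit_iff_isUnit_det _).1 hVu
  have hLd := (isUnit_iff_isUnit_det _).1 hLu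
  have hUu : IsUnit V⁻¹ := (isUnit_nonsing_inv_iff).2 hVu
  have hU : UpperTri V⁻¹ := hV.inv hVu
  have hW : UpperTri ((M * V)ᵀ)⁻¹ := hL.transpose.inv hLT
  have hW1 : ∀ i, ((M * V)ᵀ)⁻¹ i i = 1 := fun i => by
    have h := hL.transpose.mul_apply_diag hW i
    rw [mul_nonsing_inv _ ((isUnit_iff_isUnit_det _).1 hLT), one_apply_eq, transpose_apply, hL1,
      one_mul] at h
    exact h.symm
  have hLV : M * V * V⁻¹ = M := by rw [Matrix.mul_assoc, mul_nonsing_inv _ hVd, Matrix.mul_one]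
  have hMW : Mᵀ * ((M * V)ᵀ)⁻¹ = (V⁻¹)ᵀ := by
    conv_lhs => rw [← hLV]
    rw [transpose_mul, hLV, Matrix.mul_assoc, mul_nonsing_inv _ ((isUnit_iff_isUnit_det _).1 hLT),
      Matrix.mul_one]
  have hMB : specNorm M ≤ B := by linarith
  have hMB' : specNorm Mᵀ ≤ B := by rwa [specNorm_transpose]
  have hlow : ∀ i j, i < j → (Mᵀ * ((M * V)ᵀ)⁻¹) i j = 0 := fun i j h => by
    rw [hMW]; exact hU j i h
  have hdiag := (infSup_transpose_of_psub hγ hM).abs_mul_apply_diag_le hB0 hγ hMB' hW hW1 hlow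
  have hupper : upperPart (Mᵀ * ((M * V)ᵀ)⁻¹) =
      diagonal fun i => (Mᵀ * ((M * V)ᵀ)⁻¹) i i := by
    ext i j
    rw [upperPart_apply, diagonal_apply]
    rcases lt_trichotomy i j with h | rfl | h
    · rw [if_pos h.le, if_neg h.ne, hlow i j h]
    · simp
    · rw [if_neg h.not_ge, if_neg h.ne']
  have hLinv : specNorm (M * V)⁻¹ = specNorm ((M * V)ᵀ)⁻¹ := by
    rw [← transpose_nonsing_inv, specNorm_transpose]
  have hbound : specNorm V ≤ K 1 * (n : ℝ) ^ e ∧ specNorm (M * V)⁻¹ ≤ K δ * (n : ℝ) ^ e := by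
    rcases Nat.eq_zero_or_pos n with rfl | hn
    · have hz : ∀ A : Matrix (Fin 0) (Fin 0) ℝ, specNorm A = 0 := fun A =>
        le_antisymm ((specNorm_le_sqrt_frobSq A).trans (by simp [frobSq])) (specNorm_nonneg A)
      simp [hz, Real.zero_rpow he0.ne']
    · obtain ⟨l, hl1, hl2⟩ := he n hn
      have key : ∀ t, 0 < t → t / γ * (ρ ^ l * √n) + √2 * t / B * (3 ^ l * √(√n)) ≤
          K t * (n : ℝ) ^ e := fun t ht => by
        calc _ ≤ t / γ * (ρ⁻¹ * (n : ℝ) ^ e) + √2 * t / B * (n : ℝ) ^ e := by gcongr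
          _ = _ := by rw [hK]; ring
      refine ⟨(specNorm_le_of_upperPart_mul_eq_diagonal hB0 hγ zero_le_one hMB
        (infSup_of_psub hγ hM) hV (d := fun _ => 1) (by simp) (by rw [hMV, diagonal_one]) l).trans
        (key 1 one_pos), ?_⟩
      rw [hLinv]
      exact (specNorm_le_of_upperPart_mul_eq_diagonal hB0 hγ hδ0.le hMB'
        (infSup_transpose_of_psub hγ hM) hW hdiag hupper l).trans (key δ hδ0)
  refine ⟨M * V, V⁻¹, hL, hL1, hU, hLV.symm, hLu, hUu, ?_⟩
  rw [nonsing_inv_nonsing_inv _ hVd]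
  have hLn : specNorm (M * V) ≤ B * specNorm V :=
    (specNorm_mul_le _ _).trans (mul_le_mul_of_nonneg_right hMB (specNorm_nonneg _))
  have hUn : specNorm V⁻¹ ≤ specNorm (M * V)⁻¹ * B := by
    have h : V⁻¹ = (M * V)⁻¹ * (M * V * V⁻¹) := by
      rw [← Matrix.mul_assoc, nonsing_inv_mul _ hLd, Matrix.one_mul]
    rw [hLV] at h
    conv_lhs => rw [h]
    exact (specNorm_mul_le _ _).trans (mul_le_mul_of_nonneg_left hMB (specNorm_nonneg _))
  calc _ ≤ (B + 1) * (specNorm V + specNorm (M * V)⁻¹) := by linarith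
    _ ≤ (B + 1) * (K 1 * (n : ℝ) ^ e + K δ * (n : ℝ) ^ e) := by
        gcongr
        exacts [hbound.1, hbound.2]
    _ = _ := by ring
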